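/- Let ε > 0. For every δ > 0 there exists N such that for all n ≥ N, every integer ℓ ≥ 1, and every set V of vertices of the lift containing at least max{9εℓ, ℓ−n} vertices from each fiber, the following holds with probability at least 1 − δ for a uniformly random ℓ-lift G of K_n: for every subset U ⊆ V(G), |N(U) ∩ V| ≥ min{ ε·n·|U| , ε⁶·ℓ·n }. -/

import Mathlib

/-- The `ℓ`-lift of the complete graph `K_n` determined by a family of permutations
`σ` (only the values `σ i j` for `i < j` matter): vertices `(i,a)` and `(j, σ i j a)`
are adjacent for `i < j`. -/
def liftGraph (n ℓ : ℕ) (σ : Fin n → Fin n → Equiv.Perm (Fin ℓ)) :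
    SimpleGraph (Fin n × Fin ℓ) :=
  SimpleGraph.fromRel (fun x y => x.1 < y.1 ∧ σ x.1 y.1 x.2 = y.2)

/-- The proportion of `ℓ`-lifts of `K_n` (all chosen uniformly at random) whose lift
graph satisfies the property `p`. -/
noncomputable def liftProb (n ℓ : ℕ) (p : SimpleGraph (Fin n × Fin ℓ) → Prop) : ℝ :=
  ((@Finset.filter _ (fun σ : Fin n → Fin n → Equiv.Perm (Fin ℓ) => p (liftGraph n ℓ σ))
      (Classical.decPred _) Finset.univ).card : ℝ)
    / (Fintype.card (Fin n → Fin n → Equiv.Perm (Fin ℓ)) : ℝ)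

/-- `N(U)`: the set of vertices that are in `U` or have a neighbor in `U`. -/
def nbhdSet {V : Type*} (G : SimpleGraph V) (U : Set V) : Set V :=
  {v | v ∈ U ∨ ∃ u ∈ U, G.Adj u v}

open Finset in
/-- The vertices `(j, σ i j a)` of `V` obtained from the triples `((i, a), j)` in `T`. -/
def hitSet {ι : Type*} [DecidableEq ι] {ℓ : ℕ} (V : Finset (ι × Fin ℓ))
    (T : Finset ((ι × Fin ℓ) × ι)) (σ : ι → ι → Equiv.Perm (Fin ℓ)) : Finset (ι × Fin ℓ) :=
  T.image (fun p => (p.2, σ p.1.1 p.2 p.1.2)) ∩ V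

section Moment

variable {ι : Type*} [DecidableEq ι] {ℓ : ℕ}

open Finset

/-- Given the positions of the vertices in `T`, only few choices of the image of a new vertex
fail to enlarge the hit set. -/
theorem card_wasted_le [Fintype ι] (V : Finset (ι × Fin ℓ)) (T : Finset ((ι × Fin ℓ) × ι))
    (σ : ι → ι → Equiv.Perm (Fin ℓ)) (i j : ι) (K : ℕ) (q : ℝ) (hq1 : q ≤ 1)
    (hT : (T.filter (fun p => p.2 = j)).card + 1 ≤ K)
    (hV : (K : ℝ) - 1 + (univ.filter (fun b => (j, b) ∉ V)).card ≤ q * ℓ) :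
    (((univ.filter (fun x => ((i, x), j) ∉ T)).filter
      (fun x => ¬ ((j, σ i j x) ∈ V ∧
        (j, σ i j x) ∉ T.image (fun p => (p.2, σ p.1.1 p.2 p.1.2))))).card : ℝ)
      ≤ q * (univ.filter (fun x => ((i, x), j) ∉ T)).card := by
  set R := univ.filter (fun x => ((i, x), j) ∉ T) with hR
  set R' := univ.filter (fun x : Fin ℓ => ((i, x), j) ∈ T) with hR'
  set W := R.filter (fun x => ¬ ((j, σ i j x) ∈ V ∧
        (j, σ i j x) ∉ T.image (fun p => (p.2, σ p.1.1 p.2 p.1.2)))) with hW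
  have hRR : R'.card + R.card = ℓ := by
    have := Finset.card_filter_add_card_filter_not (s := (univ : Finset (Fin ℓ)))
      (fun x => ((i, x), j) ∈ T)
    simpa using this
  have hWR : W.card + R'.card ≤ (T.filter (fun p => p.2 = j)).card
      + (univ.filter (fun b => (j, b) ∉ V)).card := by
    have hdisj : Disjoint W R' := by
      rw [Finset.disjoint_left]
      intro x hx hx'
      simp only [hW, hR, hR', mem_filter, mem_univ, true_and] at hx hx'
      exact hx.1 hx'
    rw [← card_union_of_disjoint hdisj, ← card_image_of_injective _ (σ i j).injective]
    calc _ ≤ ((T.filter (fun p => p.2 = j)).image (fun p => σ p.1.1 p.2 p.1.2) ∪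
        univ.filter (fun b => (j, b) ∉ V)).card := by
          apply card_le_card
          intro y hy
          obtain ⟨x, hx, rfl⟩ := mem_image.1 hy
          rw [mem_union]
          rcases mem_union.1 hx with hx | hx
          · simp only [hW, mem_filter] at hx
            have h2 := hx.2
            by_cases hv : (j, σ i j x) ∈ V
            · left
              have h3 : (j, σ i j x) ∈ T.image (fun p => (p.2, σ p.1.1 p.2 p.1.2)) := by
                by_contra h; exact h2 ⟨hv, h⟩
              obtain ⟨p, hp, hpe⟩ := mem_image.1 h3
              simp only [Prod.mk.injEq] at hpe
              exact mem_image.2 ⟨p, mem_filter.2 ⟨hp, hpe.1⟩, hpe.2⟩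
            · right; simpa using hv
          · left
            simp only [hR', mem_filter, mem_univ, true_and] at hx
            exact mem_image.2 ⟨((i, x), j), mem_filter.2 ⟨hx, rfl⟩, rfl⟩
      _ ≤ _ := (card_union_le _ _).trans (Nat.add_le_add_right card_image_le _)
  have h1 : (W.card : ℝ) + R'.card ≤ (T.filter (fun p => p.2 = j)).card
      + (univ.filter (fun b => (j, b) ∉ V)).card := by exact_mod_cast hWR
  have h2 : (R'.card : ℝ) + R.card = ℓ := by exact_mod_cast hRR
  have h3 : ((T.filter (fun p => p.2 = j)).card : ℝ) + 1 ≤ K := by exact_mod_cast hT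
  have h4 : 0 ≤ (1 - q) * (R'.card : ℝ) := mul_nonneg (by linarith) (by positivity)
  rw [← h2] at hV
  nlinarith

/-- Exponential moment bound for the size of the hit set. -/
theorem sum_pow_card_hitSet_le [Fintype ι] (V : Finset (ι × Fin ℓ)) (K : ℕ) (s q : ℝ)
    (hs0 : 0 ≤ s) (hs1 : s ≤ 1) (hq0 : 0 ≤ q) (hq1 : q ≤ 1)
    (hV : ∀ j, (K : ℝ) - 1 + (univ.filter (fun b => (j, b) ∉ V)).card ≤ q * ℓ)
    (T : Finset ((ι × Fin ℓ) × ι)) (hT : ∀ j, (T.filter (fun p => p.2 = j)).card ≤ K) :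
    ∑ σ : ι → ι → Equiv.Perm (Fin ℓ), s ^ (hitSet V T σ).card
      ≤ Fintype.card (ι → ι → Equiv.Perm (Fin ℓ)) * (q + s * (1 - q)) ^ T.card := by
  induction T using Finset.induction_on with
  | empty => simp [hitSet]
  | insert p T hp ih =>
    obtain ⟨⟨i, a⟩, j⟩ := p
    have ih := ih fun j => (card_le_card (filter_subset_filter _ (subset_insert _ _))).trans (hT j)
    have hTj : (T.filter (fun p => p.2 = j)).card + 1 ≤ K := by
      have := hT j
      rw [filter_insert, if_pos rfl, card_insert_of_notMem (by simp [hp])] at this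
      exact this
    set R := univ.filter (fun x => ((i, x), j) ∉ T) with hR
    have haR : a ∈ R := by simpa [hR] using hp
    have hRpos : (0 : ℝ) < R.card := by exact_mod_cast card_pos.2 ⟨a, haR⟩
    set c := q + s * (1 - q) with hc
    have hc0 : 0 ≤ c := add_nonneg hq0 (mul_nonneg hs0 (by linarith))
    let im := fun σ : ι → ι → Equiv.Perm (Fin ℓ) =>
      T.image (fun p => (p.2, σ p.1.1 p.2 p.1.2))
    let good := fun (σ : ι → ι → Equiv.Perm (Fin ℓ)) x =>
      (j, σ i j x) ∈ V ∧ (j, σ i j x) ∉ im σ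
    let tw : Fin ℓ → (ι → ι → Equiv.Perm (Fin ℓ)) → (ι → ι → Equiv.Perm (Fin ℓ)) :=
      fun x σ => Function.update σ i (Function.update (σ i) j (σ i j * Equiv.swap a x))
    have htw : ∀ x, Function.Involutive (tw x) := by
      intro x σ
      simp only [tw, Function.update_self, Function.update_idem, mul_assoc, Equiv.swap_mul_self,
        mul_one, Function.update_eq_self]
    have him : ∀ σ, ∀ x ∈ R, im (tw x σ) = im σ := by
      intro σ x hx
      apply image_congr
      rintro ⟨⟨i', a'⟩, j'⟩ hp'
      have hp' : ((i', a'), j') ∈ T := hp'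
      simp only [Prod.mk.injEq, true_and, tw]
      by_cases hi : i' = i
      · subst hi
        by_cases hj : j' = j
        · subst hj
          simp only [Function.update_self, Equiv.Perm.mul_apply]
          rw [Equiv.swap_apply_of_ne_of_ne]
          · rintro rfl; exact hp hp'
          · rintro rfl; simp [hR] at hx; exact hx hp'
        · simp [Function.update_of_ne hj]
      · simp [Function.update_of_ne hi]
    have hval : ∀ σ x, tw x σ i j a = σ i j x := by
      intro σ x; simp [tw]
    have hstep : ∀ σ, s ^ (hitSet V (insert ((i, a), j) T) σ).card
        = s ^ (im σ ∩ V).card * (if good σ a then s else 1) := by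
      intro σ
      have : hitSet V (insert ((i, a), j) T) σ = insert (j, σ i j a) (im σ) ∩ V := by
        simp [hitSet, im, image_insert]
      rw [this]
      by_cases hv : (j, σ i j a) ∈ V
      · rw [insert_inter_of_mem hv]
        by_cases hm : (j, σ i j a) ∈ im σ
        · rw [insert_eq_of_mem (mem_inter.2 ⟨hm, hv⟩), if_neg (fun h => h.2 hm), mul_one]
        · rw [card_insert_of_notMem (fun h => hm (mem_inter.1 h).1), if_pos ⟨hv, hm⟩, pow_succ]
      · rw [insert_inter_of_notMem hv, if_neg (fun h => hv h.1), mul_one]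
    have hx : ∀ x ∈ R, ∑ σ, s ^ (hitSet V (insert ((i, a), j) T) σ).card
        = ∑ σ, s ^ (im σ ∩ V).card * (if good σ x then s else 1) := by
      intro x hx
      rw [← Equiv.sum_comp (htw x).toPerm]
      refine sum_congr rfl fun σ _ => ?_
      change s ^ (hitSet V (insert ((i, a), j) T) (tw x σ)).card = _
      rw [hstep]
      simp only [good]
      rw [him σ x hx, hval]
    have hin : ∀ σ, ∑ x ∈ R, (if good σ x then s else 1) ≤ c * R.card := by
      intro σ
      have h1 := card_wasted_le V T σ i j K q hq1 hTj (hV j)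
      have h2 : ((R.filter (good σ)).card : ℝ) + (R.filter (fun x => ¬ good σ x)).card = R.card := by
        exact_mod_cast Finset.card_filter_add_card_filter_not (s := R) (good σ)
      have h3 : ((R.filter (fun x => ¬ good σ x)).card : ℝ) ≤ q * R.card := h1
      rw [sum_ite, sum_const, sum_const, nsmul_eq_mul, nsmul_eq_mul, mul_one]
      have : 0 ≤ (1 - s) * (q * R.card - (R.filter (fun x => ¬ good σ x)).card) :=
        mul_nonneg (by linarith) (by linarith)
      rw [hc]
      nlinarith
    have hmain : R.card * ∑ σ, s ^ (hitSet V (insert ((i, a), j) T) σ).card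
        ≤ R.card * (c * ∑ σ, s ^ (im σ ∩ V).card) := by
      calc _ = ∑ x ∈ R, ∑ σ, s ^ (hitSet V (insert ((i, a), j) T) σ).card := by
            rw [sum_const, nsmul_eq_mul]
        _ = ∑ x ∈ R, ∑ σ, s ^ (im σ ∩ V).card * (if good σ x then s else 1) :=
            sum_congr rfl hx
        _ = ∑ σ, s ^ (im σ ∩ V).card * ∑ x ∈ R, (if good σ x then s else 1) := by
            rw [sum_comm]; exact sum_congr rfl fun σ _ => (mul_sum _ _ _).symm
        _ ≤ ∑ σ, s ^ (im σ ∩ V).card * (c * R.card) :=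
            sum_le_sum fun σ _ => mul_le_mul_of_nonneg_left (hin σ) (pow_nonneg hs0 _)
        _ = _ := by rw [← sum_mul]; ring
    have h5 := le_of_mul_le_mul_left hmain hRpos
    rw [card_insert_of_notMem hp, pow_succ]
    calc _ ≤ c * ∑ σ, s ^ (im σ ∩ V).card := h5
      _ ≤ c * (Fintype.card (ι → ι → Equiv.Perm (Fin ℓ)) * c ^ T.card) :=
          mul_le_mul_of_nonneg_left ih hc0
      _ = _ := by ring

open scoped Classical in
/-- Union bound over the sets `U` of size `k` whose hit set is too small. -/
theorem card_exists_hitSet_lt_le [Fintype ι] (V : Finset (ι × Fin ℓ)) (B : Finset ι) (k : ℕ)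
    (s q t : ℝ)
    (hs0 : 0 < s) (hs1 : s ≤ 1) (hq0 : 0 ≤ q) (hq1 : q ≤ 1)
    (hV : ∀ j, (k : ℝ) - 1 + (univ.filter (fun b => (j, b) ∉ V)).card ≤ q * ℓ) :
    ((univ.filter (fun σ : ι → ι → Equiv.Perm (Fin ℓ) =>
        ∃ U : Finset (ι × Fin ℓ), U.card = k ∧ ((hitSet V (U ×ˢ B) σ).card : ℝ) < t)).card : ℝ)
      ≤ Fintype.card (ι → ι → Equiv.Perm (Fin ℓ)) *
        ((Fintype.card ι * ℓ).choose k * ((q + s * (1 - q)) ^ (k * B.card) * s ^ (-t))) := by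
  set M : ℝ := (Fintype.card (ι → ι → Equiv.Perm (Fin ℓ)) : ℝ)
  have hU : ∀ U ∈ powersetCard k (univ : Finset (ι × Fin ℓ)),
      ((univ.filter (fun σ : ι → ι → Equiv.Perm (Fin ℓ) =>
        ((hitSet V (U ×ˢ B) σ).card : ℝ) < t)).card : ℝ)
      ≤ M * ((q + s * (1 - q)) ^ (k * B.card) * s ^ (-t)) := by
    intro U hU
    have hUk := (mem_powersetCard.1 hU).2
    have h1 := sum_pow_card_hitSet_le V k s q hs0.le hs1 hq0 hq1 hV (U ×ˢ B) (by
      intro j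
      rw [← hUk]
      apply card_le_card_of_injOn (fun p => p.1)
      · intro p hp
        simp only [coe_filter, mem_product, Set.mem_ofPred_eq] at hp
        exact hp.1.1
      · rintro ⟨p, j1⟩ hp ⟨p', j2⟩ hp' h
        simp only [coe_filter, mem_product, Set.mem_ofPred_eq] at hp hp' h
        rw [h, hp.2, hp'.2])
    rw [card_product, hUk] at h1
    have h2 : ((univ.filter (fun σ : ι → ι → Equiv.Perm (Fin ℓ) =>
        ((hitSet V (U ×ˢ B) σ).card : ℝ) < t)).card : ℝ) * s ^ t
        ≤ ∑ σ : ι → ι → Equiv.Perm (Fin ℓ), s ^ (hitSet V (U ×ˢ B) σ).card := by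
      rw [← nsmul_eq_mul, ← sum_const]
      refine (sum_le_sum fun σ hσ => ?_).trans
        (sum_le_sum_of_subset_of_nonneg (filter_subset _ _) fun _ _ _ => pow_nonneg hs0.le _)
      rw [← Real.rpow_natCast]
      exact Real.rpow_le_rpow_of_exponent_ge hs0 hs1 (mem_filter.1 hσ).2.le
    have h3 : s ^ t * s ^ (-t) = 1 := by
      rw [← Real.rpow_add hs0]; simp
    have h4 := mul_le_mul_of_nonneg_right (h2.trans h1) (Real.rpow_nonneg hs0.le (-t))
    rw [mul_assoc, h3, mul_one] at h4
    rw [← mul_assoc]; exact h4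
  calc _ ≤ (((powersetCard k (univ : Finset (ι × Fin ℓ))).biUnion fun U =>
        univ.filter (fun σ : ι → ι → Equiv.Perm (Fin ℓ) =>
        ((hitSet V (U ×ˢ B) σ).card : ℝ) < t)).card : ℝ) := by
        refine Nat.cast_le.2 (card_le_card fun σ hσ => ?_)
        obtain ⟨U, h1, h2⟩ := (mem_filter.1 hσ).2
        exact mem_biUnion.2 ⟨U, mem_powersetCard.2 ⟨subset_univ _, h1⟩,
          mem_filter.2 ⟨mem_univ _, h2⟩⟩
    _ ≤ ∑ U ∈ powersetCard k (univ : Finset (ι × Fin ℓ)),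
        ((univ.filter (fun σ : ι → ι → Equiv.Perm (Fin ℓ) =>
        ((hitSet V (U ×ˢ B) σ).card : ℝ) < t)).card : ℝ) := by
        exact_mod_cast card_biUnion_le
    _ ≤ ∑ U ∈ powersetCard k (univ : Finset (ι × Fin ℓ)),
        M * ((q + s * (1 - q)) ^ (k * B.card) * s ^ (-t)) := sum_le_sum hU
    _ = _ := by
        rw [sum_const, card_powersetCard, nsmul_eq_mul, card_univ, Fintype.card_prod,
          Fintype.card_fin]
        ring

end Moment

section Estimates

open Filter Topology

theorem eventually_mul_sq_mul_exp_le (C D c η : ℝ) (hc : 0 < c) (hη : 0 < η) :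
    ∃ N : ℕ, ∀ n : ℕ, N ≤ n → C * (n : ℝ) ^ 2 * Real.exp (D - c * n) ≤ η := by
  have h1 : Tendsto (fun n : ℕ => c * (n : ℝ)) atTop atTop :=
    tendsto_natCast_atTop_atTop.const_mul_atTop hc
  have h2 := ((Real.tendsto_pow_mul_exp_neg_atTop_nhds_zero 2).comp h1).const_mul
    (C * Real.exp D / c ^ 2)
  rw [mul_zero] at h2
  obtain ⟨N, hN⟩ := eventually_atTop.1 (h2.eventually (ge_mem_nhds hη))
  refine ⟨N, fun n hn => le_trans (le_of_eq ?_) (hN n hn)⟩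
  simp only [Function.comp]
  rw [sub_eq_add_neg, Real.exp_add]
  field_simp

theorem choose_le_three_mul_div_pow (m k : ℕ) (hk : 1 ≤ k) :
    (m.choose k : ℝ) ≤ (3 * m / k) ^ k := by
  have hk0 : (0 : ℝ) < k := by exact_mod_cast hk
  have h1 : (k : ℝ) ^ k / k.factorial ≤ 3 ^ k := by
    calc _ ≤ Real.exp k := Real.pow_div_factorial_le_exp _ hk0.le k
      _ = Real.exp 1 ^ k := by rw [← Real.exp_nat_mul, mul_one]
      _ ≤ 3 ^ k := by
        have := Real.exp_one_lt_three
        gcongr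
  calc (m.choose k : ℝ) ≤ m ^ k / k.factorial := Nat.choose_le_pow_div k m
    _ = (m / k) ^ k * ((k : ℝ) ^ k / k.factorial) := by
      rw [div_pow]; field_simp
    _ ≤ (m / k) ^ k * 3 ^ k := by gcongr
    _ = _ := by rw [← mul_pow]; congr 1; ring

theorem choose_mul_bound_le {n ℓ k b : ℕ} {ε s c lc A η : ℝ} (hk : 1 ≤ k)
    (hs0 : 0 < s) (hc0 : 0 ≤ c) (hc : c ≤ Real.exp lc) (hA : 3 * (n * ℓ) / k ≤ A)
    (hη : A * Real.exp (lc * b - 2 * ε * n * Real.log s) ≤ η) :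
    ((n * ℓ).choose k : ℝ) * (c ^ (k * b) * s ^ (-(2 * ε * n * k))) ≤ η ^ k := by
  have hk0 : (0 : ℝ) < k := by exact_mod_cast hk
  have hA0 : 0 ≤ A := le_trans (by positivity) hA
  have h1 : ((n * ℓ).choose k : ℝ) ≤ A ^ k := by
    refine (choose_le_three_mul_div_pow _ k hk).trans ?_
    push_cast
    gcongr
  calc _ ≤ A ^ k * (Real.exp lc ^ (k * b) * s ^ (-(2 * ε * n * k))) := by gcongr
    _ = (A * Real.exp (lc * b - 2 * ε * n * Real.log s)) ^ k := by
      rw [mul_pow, ← Real.exp_nat_mul, ← Real.exp_nat_mul, Real.rpow_def_of_pos hs0,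
        ← Real.exp_add]
      congr 2
      push_cast
      ring
    _ ≤ η ^ k := by gcongr

/-- Choice of the parameters in the exponential moment bound. -/
theorem exists_moment_parameters (ε η : ℝ) (hε : 0 < ε) (hε9 : ε ≤ 1 / 9) (hη : 0 < η) :
    ∃ N : ℕ, ∀ n : ℕ, N ≤ n → ∀ ℓ k b : ℕ, 1 ≤ ℓ → 1 ≤ k → (k : ℝ) - 1 ≤ ε ^ 5 * ℓ →
      n ≤ 2 * b + 1 →
      ∃ s q : ℝ, 0 < s ∧ s ≤ 1 ∧ 0 ≤ q ∧ q ≤ 1 ∧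
        (k : ℝ) - 1 + min (ℓ - 9 * ε * ℓ) n ≤ q * ℓ ∧
        ((n * ℓ).choose k : ℝ) * ((q + s * (1 - q)) ^ (k * b) * s ^ (-(2 * ε * n * k)))
          ≤ η ^ k := by
  obtain ⟨N₁, hN₁⟩ := eventually_mul_sq_mul_exp_le 48 (2 * ε) (ε * (3 / 5)) η (by positivity) hη
  obtain ⟨N₂, hN₂⟩ := eventually_mul_sq_mul_exp_le 3 (3 * Real.log 2) (2 / 9 * Real.log 2) η
    (by positivity) hη
  refine ⟨max 9 (max N₁ N₂), fun n hn ℓ k b hℓ hk hkε hb => ?_⟩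
  have hn9 : 9 ≤ n := (le_max_left _ _).trans hn
  have hn1 := hN₁ n ((le_max_left _ _).trans ((le_max_right _ _).trans hn))
  have hn2 := hN₂ n ((le_max_right _ _).trans ((le_max_right _ _).trans hn))
  have hℓr : (1 : ℝ) ≤ ℓ := by exact_mod_cast hℓ
  have hkr : (1 : ℝ) ≤ k := by exact_mod_cast hk
  have hnr : (9 : ℝ) ≤ n := by exact_mod_cast hn9
  have hbr : (n : ℝ) ≤ 2 * b + 1 := by exact_mod_cast hb
  have hl2 := Real.log_two_lt_d9
  have hl2' := Real.log_two_gt_d9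
  have hε4 : ε ^ 4 ≤ (1 / 9) ^ 4 := by gcongr
  have hε5 : ε ^ 5 ≤ (1 / 9) ^ 5 := by gcongr
  by_cases hcase : (ℓ : ℝ) ≤ 16 * n
  · have hε5' : ε ^ 5 * ℓ ≤ ε * ℓ := by
      have : ε ^ 5 ≤ ε := by
        rw [pow_succ]; nlinarith
      gcongr
    refine ⟨1 / 2, 1 - 8 * ε, by norm_num, by norm_num, by linarith, by linarith, ?_, ?_⟩
    · have := min_le_left ((ℓ : ℝ) - 9 * ε * ℓ) n
      linarith
    · refine choose_mul_bound_le (lc := -(4 * ε)) (A := 48 * (n : ℝ) ^ 2) hk (by norm_num)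
        (by linarith) ?_ ?_ (le_trans ?_ hn1)
      · have := Real.add_one_le_exp (-(4 * ε))
        linarith
      · rw [div_le_iff₀ (by linarith)]
        calc 3 * ((n : ℝ) * ℓ) ≤ 3 * (n * (16 * n)) := by gcongr
          _ = 48 * (n : ℝ) ^ 2 * 1 := by ring
          _ ≤ _ := by gcongr
      · refine mul_le_mul_of_nonneg_left (Real.exp_le_exp.2 ?_) (by positivity)
        rw [one_div, Real.log_inv]
        have h1 : ε * (n : ℝ) * Real.log 2 ≤ ε * n * (7 / 10) := by gcongr; linarith
        have h2 : ε * (n : ℝ) ≤ ε * (2 * b + 1) := by gcongr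
        linarith
  · push Not at hcase
    set q : ℝ := (n + k - 1) / ℓ with hq
    have hℓ0 : (0 : ℝ) < ℓ := by linarith
    have hqℓ : q * ℓ = n + k - 1 := by rw [hq]; field_simp
    have hq0 : 0 < q := by rw [hq]; apply div_pos <;> linarith
    have hq8 : q ≤ 1 / 8 := by
      rw [hq, div_le_iff₀ hℓ0]
      have : ε ^ 5 * ℓ ≤ (1 / 9) ^ 5 * ℓ := by gcongr
      linarith
    have hlq : Real.log q ≤ -(3 * Real.log 2) := by
      have := Real.log_le_log hq0 hq8
      have h8 : (1 / 8 : ℝ) = (2 ^ 3)⁻¹ := by norm_num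
      rwa [h8, Real.log_inv, Real.log_pow] at this
    refine ⟨q, q, hq0, by linarith, hq0.le, by linarith, ?_, ?_⟩
    · have := min_le_right ((ℓ : ℝ) - 9 * ε * ℓ) n
      linarith
    · refine choose_mul_bound_le (lc := Real.log 2 + Real.log q)
        (A := 3 * (n : ℝ) ^ 2 * Real.exp (-Real.log q)) hk hq0
        (by nlinarith) ?_ ?_ (le_trans ?_ hn2)
      · rw [Real.exp_add, Real.exp_log hq0, Real.exp_log (by norm_num)]
        nlinarith
      · rw [Real.exp_neg, Real.exp_log hq0, div_le_iff₀ (by linarith), ← div_eq_mul_inv,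
          div_mul_eq_mul_div, le_div_iff₀ hq0]
        have h1 : (n : ℝ) + k - 1 ≤ n * k := by nlinarith
        calc 3 * ((n : ℝ) * ℓ) * q = 3 * n * (q * ℓ) := by ring
          _ ≤ 3 * n * (n * k) := by rw [hqℓ]; gcongr
          _ = _ := by ring
      · rw [mul_assoc, ← Real.exp_add]
        refine mul_le_mul_of_nonneg_left (Real.exp_le_exp.2 ?_) (by positivity)
        have h1 : (Real.log 2 + Real.log q) * b ≤ (Real.log 2 + Real.log q) * (4 / 9 * n) := by
          apply mul_le_mul_of_nonpos_left <;> linarith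
        have h2 : -(2 * ε * n * Real.log q) ≤ -(2 * (1 / 9) * n * Real.log q) := by
          have : ε * n * (-Real.log q) ≤ (1 / 9) * n * (-Real.log q) := by
            have : 0 ≤ -Real.log q := by linarith
            gcongr
          linarith
        have h3 : (2 / 9 * n - 1) * Real.log q ≤ (2 / 9 * n - 1) * (-(3 * Real.log 2)) := by
          apply mul_le_mul_of_nonneg_left hlq; linarith
        linarith

end Estimates

section Lift

open Finset

open scoped Classical in
theorem card_exists_small_hitSet_le (ε η : ℝ) (hε : 0 < ε) (hε9 : ε ≤ 1 / 9) (hη : 0 < η) :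
    ∃ N : ℕ, ∀ n : ℕ, N ≤ n → ∀ ℓ : ℕ, 1 ≤ ℓ → ∀ V : Finset (Fin n × Fin ℓ),
      (∀ j, ((univ.filter (fun b => (j, b) ∉ V)).card : ℝ) ≤ min (ℓ - 9 * ε * ℓ) n) →
      ∀ B : Finset (Fin n), n ≤ 2 * B.card + 1 →
      ((univ.filter (fun σ : Fin n → Fin n → Equiv.Perm (Fin ℓ) =>
        ∃ U : Finset (Fin n × Fin ℓ), 1 ≤ U.card ∧ (U.card : ℝ) - 1 ≤ ε ^ 5 * ℓ ∧
          ((hitSet V (U ×ˢ B) σ).card : ℝ) < 2 * ε * n * U.card)).card : ℝ)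
      ≤ Fintype.card (Fin n → Fin n → Equiv.Perm (Fin ℓ)) * η := by
  set θ : ℝ := min (1 / 2) (η / 2)
  have hθ0 : 0 < θ := lt_min (by norm_num) (by positivity)
  have hθ1 : θ ≤ 1 / 2 := min_le_left _ _
  have hθ2 : θ ≤ η / 2 := min_le_right _ _
  obtain ⟨N, hN⟩ := exists_moment_parameters ε θ hε hε9 hθ0
  refine ⟨N, fun n hn ℓ hℓ V hV B hB => ?_⟩
  set M : ℝ := (Fintype.card (Fin n → Fin n → Equiv.Perm (Fin ℓ)) : ℝ)
  let bad : ℕ → Finset (Fin n → Fin n → Equiv.Perm (Fin ℓ)) := fun k =>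
    univ.filter (fun σ => ∃ U : Finset (Fin n × Fin ℓ), U.card = k ∧
      ((hitSet V (U ×ˢ B) σ).card : ℝ) < 2 * ε * n * k)
  have hbad : ∀ k : ℕ, 1 ≤ k → (k : ℝ) - 1 ≤ ε ^ 5 * ℓ → ((bad k).card : ℝ) ≤ M * θ ^ k := by
    intro k hk hkε
    obtain ⟨s, q, hs0, hs1, hq0, hq1, hkq, hle⟩ := hN n hn ℓ k B.card hℓ hk hkε hB
    have := card_exists_hitSet_lt_le V B k s q (2 * ε * n * k) hs0 hs1 hq0 hq1
      (fun j => le_trans (by linarith [hV j]) hkq)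
    rw [Fintype.card_fin] at this
    exact this.trans (mul_le_mul_of_nonneg_left hle (Nat.cast_nonneg _))
  set K := ⌊ε ^ 5 * ℓ⌋₊ + 1
  have hK : 0 ≤ ε ^ 5 * ℓ := by positivity
  calc _ ≤ (((range K).biUnion fun k => bad (k + 1)).card : ℝ) := by
        refine Nat.cast_le.2 (card_le_card fun σ hσ => ?_)
        obtain ⟨U, h1, h2, h3⟩ := (mem_filter.1 hσ).2
        obtain ⟨k, hk⟩ := Nat.exists_eq_add_of_le' h1
        refine mem_biUnion.2 ⟨k, ?_, mem_filter.2 ⟨mem_univ _, U, hk, by rwa [← hk]⟩⟩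
        rw [mem_range, Nat.lt_succ_iff]
        apply Nat.le_floor
        rw [hk] at h2
        push_cast at h2
        linarith
    _ ≤ ∑ k ∈ range K, ((bad (k + 1)).card : ℝ) := by exact_mod_cast card_biUnion_le
    _ ≤ ∑ k ∈ range K, M * θ ^ (k + 1) := by
        refine sum_le_sum fun k hk => hbad _ (Nat.le_add_left _ _) ?_
        have := (Nat.le_floor_iff hK).1 (Nat.lt_succ_iff.1 (mem_range.1 hk))
        push_cast
        linarith
    _ = M * θ * ∑ k ∈ range K, θ ^ k := by
        rw [mul_sum]; exact sum_congr rfl fun k _ => by ring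
    _ ≤ M * θ * 2 := by
        gcongr
        calc _ ≤ ∑ k ∈ range K, (1 / 2 : ℝ) ^ k := by gcongr
          _ ≤ 2 := sum_geometric_two_le K
    _ ≤ M * η := by
        rw [mul_assoc]
        gcongr
        linarith

/-- Reversal of the direction in which the permutations of a lift are read. -/
def reversePerms {ι : Type*} {ℓ : ℕ} (σ : ι → ι → Equiv.Perm (Fin ℓ)) :
    ι → ι → Equiv.Perm (Fin ℓ) := fun i j => (σ j i)⁻¹

theorem reversePerms_involutive {ι : Type*} {ℓ : ℕ} :
    Function.Involutive (reversePerms : (ι → ι → Equiv.Perm (Fin ℓ)) → _) := by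
  intro σ
  funext i j
  simp [reversePerms]

theorem hitSet_subset_nbhdSet {n ℓ : ℕ} {σ : Fin n → Fin n → Equiv.Perm (Fin ℓ)}
    {V U : Finset (Fin n × Fin ℓ)} {B : Finset (Fin n)} {W : Set (Fin n × Fin ℓ)}
    (hU : (U : Set (Fin n × Fin ℓ)) ⊆ W) (h : ∀ u ∈ U, ∀ j ∈ B, u.1 < j) :
    (hitSet V (U ×ˢ B) σ : Set (Fin n × Fin ℓ)) ⊆ nbhdSet (liftGraph n ℓ σ) W ∩ V := by
  intro v hv
  obtain ⟨hv, hvV⟩ := mem_inter.1 hv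
  obtain ⟨⟨u, j⟩, hp, rfl⟩ := mem_image.1 hv
  obtain ⟨hu, hj⟩ := mem_product.1 hp
  have hlt := h u hu j hj
  refine ⟨Or.inr ⟨u, hU hu, ?_⟩, hvV⟩
  rw [liftGraph, SimpleGraph.fromRel_adj]
  exact ⟨fun e => hlt.ne (congrArg Prod.fst e), Or.inl ⟨hlt, rfl⟩⟩

theorem hitSet_reversePerms_subset_nbhdSet {n ℓ : ℕ} {σ : Fin n → Fin n → Equiv.Perm (Fin ℓ)}
    {V U : Finset (Fin n × Fin ℓ)} {B : Finset (Fin n)} {W : Set (Fin n × Fin ℓ)}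
    (hU : (U : Set (Fin n × Fin ℓ)) ⊆ W) (h : ∀ u ∈ U, ∀ j ∈ B, j < u.1) :
    (hitSet V (U ×ˢ B) (reversePerms σ) : Set (Fin n × Fin ℓ)) ⊆
      nbhdSet (liftGraph n ℓ σ) W ∩ V := by
  intro v hv
  obtain ⟨hv, hvV⟩ := mem_inter.1 hv
  obtain ⟨⟨u, j⟩, hp, rfl⟩ := mem_image.1 hv
  obtain ⟨hu, hj⟩ := mem_product.1 hp
  have hlt := h u hu j hj
  refine ⟨Or.inr ⟨u, hU hu, ?_⟩, hvV⟩
  rw [liftGraph, SimpleGraph.fromRel_adj]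
  exact ⟨fun e => hlt.ne' (congrArg Prod.fst e), Or.inr ⟨hlt, by simp [reversePerms]⟩⟩

theorem min_le_ncard_nbhdSet_inter {n ℓ h : ℕ} {ε : ℝ} (hε : 0 < ε) (hℓ : 1 ≤ ℓ)
    {σ : Fin n → Fin n → Equiv.Perm (Fin ℓ)} {V : Finset (Fin n × Fin ℓ)}
    (h₁ : ∀ U : Finset (Fin n × Fin ℓ), 1 ≤ U.card → (U.card : ℝ) - 1 ≤ ε ^ 5 * ℓ →
      2 * ε * n * U.card ≤
        (hitSet V (U ×ˢ univ.filter (fun j : Fin n => h ≤ j.val)) σ).card)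
    (h₂ : ∀ U : Finset (Fin n × Fin ℓ), 1 ≤ U.card → (U.card : ℝ) - 1 ≤ ε ^ 5 * ℓ →
      2 * ε * n * U.card ≤
        (hitSet V (U ×ˢ univ.filter (fun j : Fin n => j.val < h)) (reversePerms σ)).card)
    (W : Set (Fin n × Fin ℓ)) :
    min (ε * n * W.ncard) (ε ^ 6 * ℓ * n) ≤ ((nbhdSet (liftGraph n ℓ σ) W ∩ V).ncard : ℝ) := by
  classical
  have hpos : 0 < ε ^ 5 * ℓ := mul_pos (by positivity) (by exact_mod_cast hℓ)
  set K := ⌈ε ^ 5 * ℓ⌉₊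
  have hK1 : ε ^ 5 * ℓ ≤ K := Nat.le_ceil _
  have hK2 : (K : ℝ) < ε ^ 5 * ℓ + 1 := Nat.ceil_lt_add_one hpos.le
  obtain ⟨U, hUW, hUc⟩ : ∃ U : Finset (Fin n × Fin ℓ), U ⊆ W.toFinite.toFinset ∧
      U.card = min W.ncard K := by
    apply exists_subset_card_eq
    rw [← Set.ncard_eq_toFinset_card W W.toFinite]
    exact min_le_left _ _
  have hUW' : ∀ u ∈ U, u ∈ W := fun u hu => by simpa using hUW hu
  have hmin : min (ε * n * W.ncard) (ε ^ 6 * ℓ * n) ≤ ε * n * U.card := by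
    rw [hUc]
    rcases le_total W.ncard K with hle | hle
    · rw [min_eq_left hle]; exact min_le_left _ _
    · rw [min_eq_right hle]
      refine (min_le_right _ _).trans ?_
      calc ε ^ 6 * ℓ * n = ε * n * (ε ^ 5 * ℓ) := by ring
        _ ≤ _ := by gcongr
  refine hmin.trans ?_
  have hUK : (U.card : ℝ) - 1 ≤ ε ^ 5 * ℓ := by
    have : (U.card : ℝ) ≤ K := by exact_mod_cast hUc ▸ min_le_right _ _
    linarith
  rcases Nat.eq_zero_or_pos U.card with h0 | h0
  · rw [h0]; simp
  have hkey : ∀ U' ⊆ U, ∀ X : Finset (Fin n × Fin ℓ), U.card ≤ 2 * U'.card →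
      (1 ≤ U'.card → (U'.card : ℝ) - 1 ≤ ε ^ 5 * ℓ → 2 * ε * n * U'.card ≤ X.card) →
      (X : Set (Fin n × Fin ℓ)) ⊆ nbhdSet (liftGraph n ℓ σ) W ∩ V →
      ε * n * U.card ≤ ((nbhdSet (liftGraph n ℓ σ) W ∩ V).ncard : ℝ) := by
    intro U' hU' X hc hX hsub
    have h3 : (U'.card : ℝ) ≤ U.card := by exact_mod_cast card_le_card hU'
    have h4 : (U.card : ℝ) ≤ 2 * U'.card := by exact_mod_cast hc
    have h5 : (X.card : ℝ) ≤ ((nbhdSet (liftGraph n ℓ σ) W ∩ V).ncard : ℝ) := by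
      rw [← Set.ncard_coe_finset X]
      exact_mod_cast Set.ncard_le_ncard hsub (Set.toFinite _)
    calc ε * n * U.card ≤ ε * n * (2 * U'.card) := by gcongr
      _ = 2 * ε * n * U'.card := by ring
      _ ≤ X.card := hX (by omega) (by linarith)
      _ ≤ _ := h5
  have hsplit := card_filter_add_card_filter_not (s := U) (fun u => u.1.val < h)
  rcases le_total (U.filter (fun u => ¬ u.1.val < h)).card (U.filter (fun u => u.1.val < h)).card
    with hle | hle
  · refine hkey (U.filter (fun u => u.1.val < h)) (filter_subset _ _) _ (by omega) (h₁ _) (hitSet_subset_nbhdSet ?_ ?_)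
    · intro u hu; exact hUW' u (mem_filter.1 hu).1
    · intro u hu j hj
      exact Fin.lt_def.2 ((mem_filter.1 hu).2.trans_le (mem_filter.1 hj).2)
  · refine hkey (U.filter (fun u => ¬ u.1.val < h)) (filter_subset _ _) _ (by omega) (h₂ _)
      (hitSet_reversePerms_subset_nbhdSet ?_ ?_)
    · intro u hu; exact hUW' u (mem_filter.1 hu).1
    · intro u hu j hj
      exact Fin.lt_def.2 ((mem_filter.1 hj).2.trans_le (not_lt.1 (mem_filter.1 hu).2))

theorem card_fiber_compl_le {n ℓ : ℕ} {ε : ℝ} (V : Finset (Fin n × Fin ℓ)) (j : Fin n)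
    (hV : max (9 * ε * ℓ) ((ℓ : ℝ) - n) ≤ (({v ∈ (V : Set (Fin n × Fin ℓ)) | v.1 = j}).ncard : ℝ)) :
    ((univ.filter (fun b => (j, b) ∉ V)).card : ℝ) ≤ min (ℓ - 9 * ε * ℓ) n := by
  have h1 : {v ∈ (V : Set (Fin n × Fin ℓ)) | v.1 = j} =
      ((univ.filter (fun b => (j, b) ∈ V)).image (fun b => (j, b)) : Finset (Fin n × Fin ℓ)) := by
    ext ⟨i, b⟩
    simp only [Set.mem_ofPred_eq, mem_coe, mem_image, mem_filter, mem_univ, true_and,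
      Prod.mk.injEq]
    constructor
    · rintro ⟨h, rfl⟩; exact ⟨b, h, rfl, rfl⟩
    · rintro ⟨b', h, rfl, rfl⟩; exact ⟨h, rfl⟩
  rw [h1, Set.ncard_coe_finset, card_image_of_injective _ (fun b b' h => (Prod.mk.inj h).2)] at hV
  have h2 : ((univ.filter (fun b => (j, b) ∈ V)).card : ℝ) +
      (univ.filter (fun b => (j, b) ∉ V)).card = ℓ := by
    have := card_filter_add_card_filter_not (s := (univ : Finset (Fin ℓ))) (fun b => (j, b) ∈ V)
    rw [card_univ, Fintype.card_fin] at this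
    exact_mod_cast this
  have h3 := (le_max_left _ _).trans hV
  have h4 := (le_max_right _ _).trans hV
  exact le_min (by linarith) (by linarith)

end Lift

/-- Expansion into a fixed set `V` containing at least `max {9εℓ, ℓ-n}` vertices of each
fiber: with probability at least `1 - δ`, every `U ⊆ V(G)` satisfies
`|N(U) ∩ V| ≥ min {εn|U|, ε⁶ℓn}`. -/
theorem stmt10 (ε : ℝ) (hε : 0 < ε) (δ : ℝ) (hδ : 0 < δ) :
    ∃ N : ℕ, ∀ n : ℕ, N ≤ n → ∀ ℓ : ℕ, 1 ≤ ℓ →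
      ∀ V : Set (Fin n × Fin ℓ),
        (∀ i : Fin n, max (9 * ε * ℓ) ((ℓ : ℝ) - n) ≤ (({v ∈ V | v.1 = i}).ncard : ℝ)) →
        1 - δ ≤ liftProb n ℓ (fun G =>
          ∀ U : Set (Fin n × Fin ℓ),
            min (ε * n * U.ncard) (ε ^ 6 * ℓ * n) ≤ ((nbhdSet G U ∩ V).ncard : ℝ)) := by
  classical
  by_cases hε9 : ε ≤ 1 / 9
  · obtain ⟨N, hN⟩ := card_exists_small_hitSet_le ε (δ / 2) hε hε9 (by positivity)
    refine ⟨N, fun n hn ℓ hℓ V hV => ?_⟩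
    lift V to Finset (Fin n × Fin ℓ) using V.toFinite
    have hVc := fun j => card_fiber_compl_le V j (hV j)
    set M := Fintype.card (Fin n → Fin n → Equiv.Perm (Fin ℓ))
    have hMpos : (0 : ℝ) < M := by exact_mod_cast Fintype.card_pos
    have hcard : (Finset.univ.filter (fun j : Fin n => j.val < n / 2)).card = n / 2 := by
      rw [Fin.card_filter_val_lt]
      omega
    have hcard' : (Finset.univ.filter (fun j : Fin n => n / 2 ≤ j.val)).card = n - n / 2 := by
      have := Finset.card_filter_add_card_filter_not (s := (Finset.univ : Finset (Fin n)))
        (fun j => j.val < n / 2)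
      simp only [not_lt, Finset.card_univ, Fintype.card_fin] at this
      omega
    have hb₁ := hN n hn ℓ hℓ V hVc (Finset.univ.filter (fun j : Fin n => n / 2 ≤ j.val))
      (by omega)
    have hb₂ := hN n hn ℓ hℓ V hVc (Finset.univ.filter (fun j : Fin n => j.val < n / 2))
      (by omega)
    set S₁ := Finset.univ.filter (fun σ : Fin n → Fin n → Equiv.Perm (Fin ℓ) =>
        ∃ U : Finset (Fin n × Fin ℓ), 1 ≤ U.card ∧ (U.card : ℝ) - 1 ≤ ε ^ 5 * ℓ ∧
          ((hitSet V (U ×ˢ Finset.univ.filter (fun j : Fin n => n / 2 ≤ j.val)) σ).card : ℝ)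
            < 2 * ε * n * U.card) with hS₁
    set S₂ := Finset.univ.filter (fun σ : Fin n → Fin n → Equiv.Perm (Fin ℓ) =>
        ∃ U : Finset (Fin n × Fin ℓ), 1 ≤ U.card ∧ (U.card : ℝ) - 1 ≤ ε ^ 5 * ℓ ∧
          ((hitSet V (U ×ˢ Finset.univ.filter (fun j : Fin n => j.val < n / 2)) σ).card : ℝ)
            < 2 * ε * n * U.card) with hS₂
    rw [liftProb, le_div_iff₀ hMpos]
    set G := @Finset.filter _ _ (Classical.decPred _)
      (Finset.univ : Finset (Fin n → Fin n → Equiv.Perm (Fin ℓ)))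
    have hcover : (Finset.univ : Finset (Fin n → Fin n → Equiv.Perm (Fin ℓ))) ⊆
        G ∪ (S₁ ∪ S₂.image reversePerms) := by
      intro σ _
      by_cases h₁ : σ ∈ S₁
      · exact Finset.mem_union_right _ (Finset.mem_union_left _ h₁)
      by_cases h₂ : reversePerms σ ∈ S₂
      · exact Finset.mem_union_right _ (Finset.mem_union_right _
          (Finset.mem_image.2 ⟨_, h₂, reversePerms_involutive σ⟩))
      refine Finset.mem_union_left _ ((@Finset.mem_filter _ _ (Classical.decPred _) _ _).2
        ⟨Finset.mem_univ _, ?_⟩)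
      simp only [hS₁, hS₂, Finset.mem_filter, Finset.mem_univ, true_and, not_exists, not_and,
        not_lt] at h₁ h₂
      exact min_le_ncard_nbhdSet_inter hε hℓ h₁ h₂
    have hle : M ≤ G.card + (S₁.card + S₂.card) := by
      calc M = (Finset.univ : Finset (Fin n → Fin n → Equiv.Perm (Fin ℓ))).card := rfl
        _ ≤ _ := (Finset.card_le_card hcover).trans ((Finset.card_union_le _ _).trans
          (Nat.add_le_add_left ((Finset.card_union_le _ _).trans
            (Nat.add_le_add_left Finset.card_image_le _)) _))
    have hle' : (M : ℝ) ≤ G.card + (S₁.card + S₂.card) := by exact_mod_cast hle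
    linarith
  · refine ⟨1, fun n hn ℓ hℓ V hV => absurd ?_ hε9⟩
    lift V to Finset (Fin n × Fin ℓ) using V.toFinite
    have h := (card_fiber_compl_le V ⟨0, hn⟩ (hV _)).trans (min_le_left _ _)
    have hℓ' : (0 : ℝ) < ℓ := by exact_mod_cast hℓ
    have h0 : (0 : ℝ) ≤ (1 - 9 * ε) * ℓ := by
      rw [sub_mul, one_mul]
      exact (Nat.cast_nonneg _).trans h
    have := nonneg_of_mul_nonneg_left h0 hℓ'
    linarith
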